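/- For every γ ≥ 0, the online algorithm A_γ that sets s(t) = min{n(t), ⌈n(t)/α^{γ}⌉} has competitive ratio at least Ω(α^{1/4}) for flow time plus linear switching cost: there exist a constant c > 0 and a threshold α₀ > 1 such that for every α ≥ α₀ there exist an arrival sequence a and a feasible schedule s' with C(A_γ) ≥ c·α^{1/4}·C(s'). -/

import Mathlib

open scoped BigOperators ENNReal

/-- Cumulative arrivals up to and including slot `t`. -/
def cumA (a : ℕ → ℕ) (t : ℕ) : ℕ := ∑ τ ∈ Finset.range (t + 1), a τ

/-- Cumulative service strictly before slot `t`. -/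
def cumS (s : ℕ → ℕ) (t : ℕ) : ℕ := ∑ τ ∈ Finset.range t, s τ

/-- Backlog (number of outstanding unit-size jobs) of schedule `s` at slot `t`. -/
def backlog (a s : ℕ → ℕ) (t : ℕ) : ℕ := cumA a t - cumS s t

/-- A schedule is feasible if it never serves more jobs than are outstanding. -/
def Feasible (a s : ℕ → ℕ) : Prop := ∀ t, s t ≤ backlog a s t

/-- Finite support of the arrival sequence. -/
def FinSupp (a : ℕ → ℕ) : Prop := ∃ T, ∀ t, T < t → a t = 0

/-- `s (t-1)` with the convention `s (-1) = 0`. -/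
def sPrev (s : ℕ → ℕ) : ℕ → ℕ
  | 0 => 0
  | t + 1 => s t

/-- Flow time plus linear switching cost, with weight `α`. -/
noncomputable def costLin (α : ℝ) (a s : ℕ → ℕ) : ℝ≥0∞ :=
  (∑' t, (backlog a s t : ℝ≥0∞)) +
    ENNReal.ofReal α * ∑' t, (((s t : ℤ) - (sPrev s t : ℤ)).natAbs : ℝ≥0∞)

/-- Flow time plus quadratic switching cost, with weight `α`. -/
noncomputable def costQuad (α : ℝ) (a s : ℕ → ℕ) : ℝ≥0∞ :=
  (∑' t, (backlog a s t : ℝ≥0∞)) +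
    ENNReal.ofReal α * ∑' t, ((((s t : ℤ) - (sPrev s t : ℤ)).natAbs ^ 2 : ℕ) : ℝ≥0∞)

/-- State machine of an online algorithm: the state at slot `t` is the pair
`(backlog at t, number of active servers at t)`, where the number of active
servers is `g` applied to the current backlog and the previous action
(with the convention that the action at slot `-1` is `0`). -/
def algState (a : ℕ → ℕ) (g : ℕ → ℕ → ℕ) : ℕ → ℕ × ℕ
  | 0 => (a 0, g (a 0) 0)
  | t + 1 =>
      let p := algState a g t
      let n := p.1 - p.2 + a (t + 1)
      (n, g n p.2)

/-- The schedule produced by the online rule `g` on arrival sequence `a`. -/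
def algSched (a : ℕ → ℕ) (g : ℕ → ℕ → ℕ) (t : ℕ) : ℕ := (algState a g t).2

/-- The rule of `A_γ`: `s(t) = min {n(t), ⌈n(t)/α^γ⌉}`. -/
noncomputable def gammaRule (α γ : ℝ) : ℕ → ℕ → ℕ :=
  fun n _ => min n ⌈(n : ℝ) / α ^ γ⌉₊

/-- The block schedule (or arrival sequence) equal to `m` on the first `N` slots, then `0`. -/
def block (m N : ℕ) (t : ℕ) : ℕ := if t < N then m else 0

/-- The state machine's first component accounts for all jobs not yet served. -/
lemma cumA_eq_algState_add_cumS (a : ℕ → ℕ) {g : ℕ → ℕ → ℕ} (hg : ∀ n p, g n p ≤ n) (t : ℕ) :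
    cumA a t = (algState a g t).1 + cumS (algSched a g) t := by
  induction t with
  | zero => simp [cumA, cumS, algState]
  | succ t ih =>
    have hle : (algState a g t).2 ≤ (algState a g t).1 := by
      cases t <;> exact hg _ _
    have hA : cumA a (t + 1) = cumA a t + a (t + 1) := Finset.sum_range_succ _ _
    have hS : cumS (algSched a g) (t + 1) = cumS (algSched a g) t + (algState a g t).2 :=
      Finset.sum_range_succ _ _
    have hn : (algState a g (t + 1)).1
        = (algState a g t).1 - (algState a g t).2 + a (t + 1) := rfl
    omega

lemma backlog_algSched (a : ℕ → ℕ) {g : ℕ → ℕ → ℕ} (hg : ∀ n p, g n p ≤ n) (t : ℕ) :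
    backlog a (algSched a g) t = (algState a g t).1 := by
  rw [backlog, cumA_eq_algState_add_cumS a hg t, Nat.add_sub_cancel]

lemma gammaRule_le (α γ : ℝ) (n p : ℕ) : gammaRule α γ n p ≤ n := min_le_left _ _

lemma tsum_switching_block_le (m N : ℕ) :
    ∑' t, ((((block m N t : ℤ) - (sPrev (block m N) t : ℤ)).natAbs : ℕ) : ℝ≥0∞) ≤ 2 * m := by
  have h : ∀ t, ((((block m N t : ℤ) - (sPrev (block m N) t : ℤ)).natAbs : ℕ) : ℝ≥0∞)
      ≤ (if t = 0 then (m : ℝ≥0∞) else 0) + (if t = N then (m : ℝ≥0∞) else 0) := by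
    intro t
    have h' : ((block m N t : ℤ) - (sPrev (block m N) t : ℤ)).natAbs
        ≤ (if t = 0 then m else 0) + (if t = N then m else 0) := by
      cases t with
      | zero => simp only [block, sPrev]; split_ifs <;> simp
      | succ t => simp only [block, sPrev]; split_ifs <;> omega
    exact_mod_cast h'
  refine (ENNReal.tsum_le_tsum h).trans ?_
  rw [ENNReal.tsum_add, tsum_ite_eq, tsum_ite_eq, two_mul]

lemma cumS_block_one (N t : ℕ) : cumS (block 1 N) t = min t N := by
  induction t with
  | zero => simp [cumS]
  | succ t ih =>
    have hS : cumS (block 1 N) (t + 1) = cumS (block 1 N) t + block 1 N t :=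
      Finset.sum_range_succ _ _
    rw [hS, ih, block]
    split_ifs <;> omega

lemma cumA_block_one (N t : ℕ) : cumA (block N 1) t = N := by
  rw [cumA, Finset.sum_range_succ']
  simp [block]

lemma backlog_batch (N t : ℕ) : backlog (block N 1) (block 1 N) t = N - t := by
  rw [backlog, cumA_block_one, cumS_block_one]
  omega

lemma backlog_self (a : ℕ → ℕ) (t : ℕ) : backlog a a t = a t := by
  rw [backlog, cumA, cumS, Finset.sum_range_succ]
  omega

lemma finSupp_block (m N : ℕ) : FinSupp (block m N) :=
  ⟨N, fun _ ht => if_neg (by omega)⟩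

/-- Serving a batch of `N` jobs with a single server. -/
lemma costLin_batch_le (α : ℝ) (N : ℕ) :
    costLin α (block N 1) (block 1 N) ≤ (N : ℝ≥0∞) * N + ENNReal.ofReal α * 2 := by
  unfold costLin
  gcongr
  · rw [tsum_eq_sum (s := Finset.range N)]
    · refine (Finset.sum_le_card_nsmul _ _ (N : ℝ≥0∞) fun t _ => ?_).trans (by simp)
      rw [backlog_batch]
      exact_mod_cast Nat.sub_le N t
    · intro t ht
      rw [backlog_batch, Nat.sub_eq_zero_of_le (by simpa using ht), Nat.cast_zero]
  · simpa using tsum_switching_block_le 1 N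

/-- Serving a constant arrival stream as it arrives. -/
lemma costLin_block_self_le (α : ℝ) (m N : ℕ) :
    costLin α (block m N) (block m N) ≤ (N : ℝ≥0∞) * m + ENNReal.ofReal α * (2 * m) := by
  unfold costLin
  gcongr
  · rw [tsum_eq_sum (s := Finset.range N)]
    · refine (Finset.sum_le_card_nsmul _ _ (m : ℝ≥0∞) fun t _ => ?_).trans (by simp)
      rw [backlog_self, block]
      split_ifs <;> simp
    · intro t ht
      rw [backlog_self, block, if_neg (by simpa using ht), Nat.cast_zero]
  · exact tsum_switching_block_le m N

/-- The switching cost is at least the cost of the initial activation. -/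
lemma le_costLin_of_initial (α : ℝ) (a s : ℕ → ℕ) :
    ENNReal.ofReal α * (s 0 : ℝ≥0∞) ≤ costLin α a s := by
  refine le_trans ?_ le_add_self
  gcongr
  refine le_trans ?_ (ENNReal.le_tsum 0)
  simp [sPrev]

/-- With two arrivals per slot, the backlog of `A_γ` climbs up to `α ^ γ` and stays there. -/
lemma min_le_algState_gammaRule {α γ : ℝ} (hβ : 1 ≤ α ^ γ) (N t : ℕ) (ht : t < N) :
    min (t : ℝ) (α ^ γ) ≤ ((algState (block 2 N) (gammaRule α γ) t).1 : ℝ) := by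
  induction t with
  | zero => simp
  | succ t ih =>
    have ih := ih (by omega)
    set n := (algState (block 2 N) (gammaRule α γ) t).1 with hn
    set s := (algState (block 2 N) (gammaRule α γ) t).2 with hs
    have hsr : s = min n ⌈(n : ℝ) / α ^ γ⌉₊ := by
      rw [hs, hn]; cases t <;> rfl
    have hsn : s ≤ n := hsr ▸ min_le_left _ _
    have hsc : s ≤ ⌈(n : ℝ) / α ^ γ⌉₊ := hsr ▸ min_le_right _ _
    have hstep : (algState (block 2 N) (gammaRule α γ) (t + 1)).1 = n - s + 2 := by
      change n - s + block 2 N (t + 1) = _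
      rw [block, if_pos ht]
    rw [hstep]
    push_cast [Nat.cast_sub hsn]
    have hpos : 0 < α ^ γ := by linarith
    rcases le_or_gt (n : ℝ) (α ^ γ) with h | h
    · have h1 : ⌈(n : ℝ) / α ^ γ⌉₊ ≤ 1 := by
        rw [Nat.ceil_le, Nat.cast_one]
        exact (div_le_one hpos).2 h
      have h2 : (s : ℝ) ≤ 1 := by exact_mod_cast hsc.trans h1
      rcases min_le_iff.1 ih with h3 | h3
      · exact (min_le_left _ _).trans (by linarith)
      · exact (min_le_right _ _).trans (by linarith)
    · have h1 : (s : ℝ) ≤ n / α ^ γ + 1 :=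
        (Nat.cast_le.2 hsc).trans (Nat.ceil_lt_add_one (by positivity)).le
      have h2 : α ^ γ - 1 ≤ n - n / α ^ γ := by
        have h3 : (n : ℝ) - n / α ^ γ - (α ^ γ - 1) = (n - α ^ γ) * (α ^ γ - 1) / α ^ γ := by
          field_simp
        have h4 : 0 ≤ (n - α ^ γ) * (α ^ γ - 1) / α ^ γ :=
          div_nonneg (mul_nonneg (by linarith) (by linarith)) hpos.le
        linarith
      exact (min_le_right _ _).trans (by linarith)

/-- Flow-time lower bound for `A_γ` under two arrivals per slot. -/
lemma le_costLin_gammaRule_block {α γ : ℝ} (hβ : 1 ≤ α ^ γ) (K : ℕ) (hK : α ^ γ ≤ K) :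
    ENNReal.ofReal (K * α ^ γ) ≤
      costLin α (block 2 (2 * K)) (algSched (block 2 (2 * K)) (gammaRule α γ)) := by
  refine le_trans ?_ le_self_add
  refine le_trans ?_ (ENNReal.sum_le_tsum (Finset.Ico K (2 * K)))
  have hcard : (Finset.Ico K (2 * K)).card = K := by rw [Nat.card_Ico]; omega
  have h := Finset.card_nsmul_le_sum (Finset.Ico K (2 * K))
    (fun t => (backlog (block 2 (2 * K)) (algSched (block 2 (2 * K)) (gammaRule α γ)) t : ℝ≥0∞))
    (ENNReal.ofReal (α ^ γ)) ?_
  · rw [hcard, nsmul_eq_mul] at h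
    rwa [ENNReal.ofReal_mul (Nat.cast_nonneg K), ENNReal.ofReal_natCast]
  · intro t ht
    rw [Finset.mem_Ico] at ht
    rw [backlog_algSched _ (gammaRule_le α γ), ← ENNReal.ofReal_natCast]
    refine ENNReal.ofReal_le_ofReal (le_trans ?_ (min_le_algState_gammaRule hβ _ t ht.2))
    exact le_min (hK.trans (by exact_mod_cast ht.1)) le_rfl

lemma ofReal_mul_le_of_bounds {r X Y : ℝ} {x y : ℝ≥0∞} (hr : 0 ≤ r)
    (hx : x ≤ ENNReal.ofReal X) (hy : ENNReal.ofReal Y ≤ y) (h : r * X ≤ Y) :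
    ENNReal.ofReal r * x ≤ y :=
  calc ENNReal.ofReal r * x ≤ ENNReal.ofReal r * ENNReal.ofReal X := by gcongr
    _ = ENNReal.ofReal (r * X) := (ENNReal.ofReal_mul hr).symm
    _ ≤ ENNReal.ofReal Y := ENNReal.ofReal_le_ofReal h
    _ ≤ y := hy

/-- for every `γ ≥ 0`, the algorithm `A_γ` has competitive ratio at
least `Ω(α^{1/4})` for flow time plus linear switching cost: there are `c > 0`
and a threshold `α₀ > 1` such that for every `α ≥ α₀` some arrival sequence and
feasible schedule witness `C(A_γ) ≥ c·α^{1/4}·C(s')`. -/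
theorem gammaRule_lower_bound (γ : ℝ) (hγ : 0 ≤ γ) :
    ∃ c : ℝ, 0 < c ∧ ∃ α₀ : ℝ, 1 < α₀ ∧ ∀ α : ℝ, α₀ ≤ α →
      ∃ (a s' : ℕ → ℕ), FinSupp a ∧ Feasible a s' ∧
        ENNReal.ofReal (c * α ^ ((1 : ℝ) / 4)) * costLin α a s' ≤
          costLin α a (algSched a (gammaRule α γ)) := by
  refine ⟨1 / 8, by norm_num, 2, by norm_num, fun α hα => ?_⟩
  have hα1 : 1 ≤ α := by linarith
  have hα0 : 0 < α := by linarith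
  have hβ : 1 ≤ α ^ γ := Real.one_le_rpow hα1 hγ
  have hβ0 : 0 < α ^ γ := by linarith
  have hq : 0 < α ^ ((1 : ℝ) / 4) := Real.rpow_pos_of_pos hα0 _
  rcases le_total γ (1 / 4) with hγ4 | hγ4
  · set N := ⌈√α⌉₊ with hN
    refine ⟨block N 1, block 1 N, finSupp_block _ _, fun t => ?_,
      ofReal_mul_le_of_bounds (X := 6 * α) (Y := α * α ^ ((1 : ℝ) / 4)) (by positivity) ?_ ?_ ?_⟩
    · rw [backlog_batch, block]
      split_ifs <;> omega
    · refine (costLin_batch_le α N).trans ?_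
      have hs1 : 1 ≤ √α := Real.one_le_sqrt.2 hα1
      have hN2 : (N : ℝ) ≤ 2 * √α := by
        have := Nat.ceil_lt_add_one (Real.sqrt_nonneg α)
        linarith
      have hNN : (N : ℝ) * N ≤ 4 * α := by
        nlinarith [Real.mul_self_sqrt hα0.le, Nat.cast_nonneg (α := ℝ) N]
      calc (N : ℝ≥0∞) * N + ENNReal.ofReal α * 2
          = ENNReal.ofReal (N * N + α * 2) := by
            rw [ENNReal.ofReal_add (by positivity) (by positivity),
              ENNReal.ofReal_mul (by positivity), ENNReal.ofReal_mul hα0.le]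
            simp
        _ ≤ _ := ENNReal.ofReal_le_ofReal (by linarith)
    · refine le_trans ?_ (le_costLin_of_initial α _ _)
      rw [ENNReal.ofReal_mul hα0.le]
      gcongr
      rw [← ENNReal.ofReal_natCast]
      refine ENNReal.ofReal_le_ofReal ?_
      have h0 : algSched (block N 1) (gammaRule α γ) 0 = min N ⌈(N : ℝ) / α ^ γ⌉₊ := rfl
      have hdiv : (N : ℝ) / α ^ γ ≤ N := div_le_self (Nat.cast_nonneg N) hβ
      rw [h0, min_eq_right (Nat.ceil_le.2 hdiv)]
      refine le_trans ?_ (Nat.le_ceil _)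
      rw [le_div_iff₀ hβ0, ← Real.rpow_add hα0]
      calc α ^ (1 / 4 + γ) ≤ α ^ ((1 : ℝ) / 2) :=
            Real.rpow_le_rpow_of_exponent_le hα1 (by linarith)
        _ = √α := (Real.sqrt_eq_rpow α).symm
        _ ≤ N := Nat.le_ceil _
    · nlinarith [mul_pos hα0 hq]
  · obtain ⟨K, hK⟩ := exists_nat_ge (max α (α ^ γ))
    have hKα : α ≤ K := (le_max_left _ _).trans hK
    have hKβ : α ^ γ ≤ K := (le_max_right _ _).trans hK
    refine ⟨block 2 (2 * K), block 2 (2 * K), finSupp_block _ _,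
      fun t => (backlog_self _ t).ge,
      ofReal_mul_le_of_bounds (X := 8 * K) (by positivity) ?_
        (le_costLin_gammaRule_block hβ K hKβ) ?_⟩
    · refine (costLin_block_self_le α 2 (2 * K)).trans ?_
      calc ((2 * K : ℕ) : ℝ≥0∞) * (2 : ℕ) + ENNReal.ofReal α * (2 * (2 : ℕ))
          = ENNReal.ofReal (((2 * K : ℕ) : ℝ) * (2 : ℕ) + α * (2 * (2 : ℕ))) := by
            rw [ENNReal.ofReal_add (by positivity) (by positivity),
              ENNReal.ofReal_mul (by positivity), ENNReal.ofReal_mul hα0.le,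
              ENNReal.ofReal_mul (by positivity)]
            simp only [ENNReal.ofReal_natCast, ENNReal.ofReal_ofNat]
        _ ≤ _ := ENNReal.ofReal_le_ofReal (by push_cast; linarith)
    · have hle : α ^ ((1 : ℝ) / 4) ≤ α ^ γ := Real.rpow_le_rpow_of_exponent_le hα1 hγ4
      nlinarith [mul_le_mul_of_nonneg_left hle (Nat.cast_nonneg (α := ℝ) K)]
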